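/- Let 0 < k < n be integers and let P be a function from the k-element subsets of [n] to ℝ. Then P is a positive tropical Plücker vector if and only if there exists a k×n matrix A with entries in the field 𝕂 = HahnSeries ℝ ℝ such that for every k-element subset I of [n] the maximal minor p_I(A) is nonzero, has positive leading coefficient lc(p_I(A)) > 0, and satisfies ord(p_I(A)) = P(I). (The positive Dressian equals the positive tropical Grassmannian.) -/

import Mathlib

/-- The order (valuation) of a Hahn series with real exponents. -/
noncomputable def ord (f : HahnSeries ℝ ℝ) : ℝ := f.order

/-- The leading coefficient of a Hahn series. -/
noncomputable def lc (f : HahnSeries ℝ ℝ) : ℝ := f.leadingCoeff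

/-- The maximal minor `p_I(A)` of a `k × n` matrix `A` on the columns indexed by the
`k`-element subset `I`, taken in increasing order (junk value `0` if `I.card ≠ k`). -/
noncomputable def pMinor {R : Type*} [CommRing R] {k n : ℕ}
    (A : Matrix (Fin k) (Fin n) R) (I : Finset (Fin n)) : R :=
  if hI : I.card = k then
    Matrix.det (Matrix.of fun r c => A r ((I.orderIsoOfFin hI c : Fin n)))
  else 0

/-- `P` is a positive tropical Plücker vector: for every `(k-2)`-subset `S` and
`a < b < c < d` outside `S`, one of the two positive tropical three-term Plücker
relations holds. -/
def IsPosTropPlucker (n k : ℕ) (P : Finset (Fin n) → ℝ) : Prop :=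
  ∀ S : Finset (Fin n), S.card + 2 = k →
    ∀ a b c d : Fin n, a < b → b < c → c < d →
      a ∉ S → b ∉ S → c ∉ S → d ∉ S →
      ((P (S ∪ {a, c}) + P (S ∪ {b, d}) = P (S ∪ {a, b}) + P (S ∪ {c, d}) ∧
        P (S ∪ {a, b}) + P (S ∪ {c, d}) ≤ P (S ∪ {a, d}) + P (S ∪ {b, c})) ∨
       (P (S ∪ {a, c}) + P (S ∪ {b, d}) = P (S ∪ {a, d}) + P (S ∪ {b, c}) ∧
        P (S ∪ {a, d}) + P (S ∪ {b, c}) ≤ P (S ∪ {a, b}) + P (S ∪ {c, d})))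


open Finset in
/-- The Vandermonde product of the entries of an integer tuple; its sign records the parity of the
permutation sorting the tuple. -/
def vandermondeProd {k : ℕ} (f : Fin k → ℤ) : ℤ :=
  ∏ i, ∏ j ∈ Ioi i, (f j - f i)

theorem vandermondeProd_cons {k : ℕ} (x : ℤ) (f : Fin k → ℤ) :
    vandermondeProd (Fin.cons x f : Fin (k + 1) → ℤ) = (∏ i, (f i - x)) * vandermondeProd f := by
  simp [vandermondeProd, Fin.prod_univ_succ, Fin.prod_Ioi_succ]

theorem vandermondeProd_pos {k : ℕ} {f : Fin k → ℤ} (hf : StrictMono f) :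
    0 < vandermondeProd f :=
  Finset.prod_pos fun _ _ => Finset.prod_pos fun _ hj => sub_pos.2 (hf (Finset.mem_Ioi.1 hj))

theorem vandermondeProd_comp_perm {k : ℕ} (f : Fin k → ℤ) (σ : Equiv.Perm (Fin k)) :
    vandermondeProd (f ∘ σ) = σ.sign * vandermondeProd f :=
  σ.prod_Ioi_comp_eq_sign_mul_prod (f := fun i j => f j - f i) fun _ _ => by ring

/-- A minor with columns in arbitrary order is, up to the sign of the sorting permutation, the
minor on the sorted columns. -/
theorem det_submatrix_eq_sign_mul_pMinor {R : Type*} [CommRing R] {k n : ℕ}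
    (A : Matrix (Fin k) (Fin n) R) {f : Fin k → Fin n} (hf : Function.Injective f)
    {I : Finset (Fin n)} (hI : I.card = k) (hfI : ∀ l, f l ∈ I) :
    (A.submatrix id f).det =
      ((vandermondeProd fun l => ((f l : ℕ) : ℤ)).sign : R) * pMinor A I := by
  have hbij : Function.Bijective (fun l => (⟨f l, hfI l⟩ : I)) := by
    rw [Fintype.bijective_iff_injective_and_card]
    exact ⟨fun x y h => hf (Subtype.ext_iff.1 h), by simp [hI]⟩
  set e := I.orderIsoOfFin hI with he
  set σ : Equiv.Perm (Fin k) := (Equiv.ofBijective _ hbij).trans e.symm.toEquiv with hσ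
  have hfe : ∀ l, f l = (e (σ l) : Fin n) := fun l => by simp [hσ]
  have h1 : A.submatrix id f =
      (Matrix.of fun r c => A r (e c : Fin n)).submatrix id σ := by
    ext r c
    simp [hfe]
  have h2 : (fun l => ((f l : ℕ) : ℤ)) = (fun l => (((e l : Fin n) : ℕ) : ℤ)) ∘ σ := by
    funext l
    simp [hfe]
  have hpos : 0 < vandermondeProd fun l => (((e l : Fin n) : ℕ) : ℤ) :=
    vandermondeProd_pos fun x y h => by
      have := e.strictMono h
      exact_mod_cast this
  have hp : (Matrix.of fun r c => A r (e c : Fin n)).det = pMinor A I := by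
    rw [pMinor, dif_pos hI]
  rw [h1, Matrix.det_permute', h2, vandermondeProd_comp_perm, Int.sign_mul,
    Int.sign_eq_one_of_pos hpos, hp]
  rcases Int.units_eq_one_or σ.sign with h | h <;> simp [h]

/-- The three-term Grassmann–Plücker relation for determinants whose last rows are fixed. -/
theorem det_cons_cons_plucker {R : Type*} [CommRing R] {m : ℕ}
    (B : Fin m → Fin (m + 2) → R) (a b c d : Fin (m + 2) → R) :
    (Matrix.of (Fin.cons a (Fin.cons c B : Fin (m + 1) → _) : Fin (m + 2) → _)).det *
      (Matrix.of (Fin.cons b (Fin.cons d B : Fin (m + 1) → _) : Fin (m + 2) → _)).det =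
    (Matrix.of (Fin.cons a (Fin.cons b B : Fin (m + 1) → _) : Fin (m + 2) → _)).det *
      (Matrix.of (Fin.cons c (Fin.cons d B : Fin (m + 1) → _) : Fin (m + 2) → _)).det +
    (Matrix.of (Fin.cons a (Fin.cons d B : Fin (m + 1) → _) : Fin (m + 2) → _)).det *
      (Matrix.of (Fin.cons b (Fin.cons c B : Fin (m + 1) → _) : Fin (m + 2) → _)).det := by
  set D : (Fin (m + 2) → R) → (Fin (m + 2) → R) → R := fun x y =>
    (Matrix.of (Fin.cons x (Fin.cons y B : Fin (m + 1) → _) : Fin (m + 2) → _)).det with hD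
  change D a c * D b d = D a b * D c d + D a d * D b c
  set M : Matrix (Fin (m + 2)) (Fin (m + 2)) R :=
    Matrix.of (Fin.cons a (Fin.cons b B : Fin (m + 1) → _) : Fin (m + 2) → _) with hM
  set N : Matrix (Fin (m + 2)) (Fin (m + 2)) R :=
    Matrix.of (Fin.cons d (Fin.cons d B : Fin (m + 1) → _) : Fin (m + 2) → _) with hN
  have swap : ∀ x y, D x y = -D y x := fun x y => by
    have h := Matrix.det_permute (Equiv.swap 0 1)
      (Matrix.of (Fin.cons y (Fin.cons x B : Fin (m + 1) → _) : Fin (m + 2) → _))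
    have h01 : (0 : Fin (m + 2)) ≠ 1 := by simp
    rw [Equiv.Perm.sign_swap h01] at h
    simp only [hD]
    rw [show (-(Matrix.of (Fin.cons y (Fin.cons x B : Fin (m + 1) → _) :
      Fin (m + 2) → _)).det : R) = _ from by simpa using h.symm]
    congr 1
    ext i j
    refine Fin.cases ?_ (fun i => Fin.cases ?_ (fun i => ?_) i) i
    · simp
    · simp
    · rw [Matrix.submatrix_apply, Equiv.swap_apply_of_ne_of_ne (by simp [Fin.ext_iff])
        (by simp [Fin.ext_iff])]
      rfl
  have key : ∀ x, Matrix.cramer N.transpose x 0 = D x d := fun x => by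
    rw [Matrix.cramer_transpose_apply]
    simp only [hD]
    congr 1
    ext i j
    refine Fin.cases ?_ (fun i => ?_) i <;> simp [hN]
  have h := congrArg (fun v => Matrix.cramer N.transpose v 0) (Matrix.mulVec_cramer M.transpose c)
  have hsum : M.transpose.mulVec (Matrix.cramer M.transpose c) =
      ∑ i, Matrix.cramer M.transpose c i • M i := by
    ext j
    simp [Matrix.mulVec, dotProduct, mul_comm]
  rw [hsum] at h
  simp only [map_sum, map_smul, Finset.sum_apply, Pi.smul_apply, smul_eq_mul] at h
  simp only [key, Fin.sum_univ_succ, Matrix.cramer_transpose_apply, Matrix.det_transpose] at h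
  have e1 : (M.updateRow 0 c).det = D c b := by
    simp only [hD]
    congr 1
    ext i j
    refine Fin.cases ?_ (fun i => ?_) i <;> simp [hM]
  have e2 : (M.updateRow (Fin.succ 0) c).det = D a c := by
    simp only [hD]
    congr 1
    ext i j
    refine Fin.cases ?_ (fun i => Fin.cases ?_ (fun i => ?_) i) i
    · rw [Matrix.updateRow_ne (by simp)]; rfl
    · rw [Matrix.updateRow_self]; rfl
    · rw [Matrix.updateRow_ne (by simp [Fin.ext_iff])]; rfl
  have e3 : ∀ i : Fin m, D (M i.succ.succ) d = 0 := fun i =>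
    Matrix.det_zero_of_row_eq (i := 0) (j := i.succ.succ) (Fin.succ_ne_zero _).symm rfl
  simp only [e1, e2, e3, mul_zero, Finset.sum_const_zero, add_zero] at h
  have e4 : M.det = D a b := rfl
  have e5 : M 0 = a := rfl
  have e6 : M (Fin.succ 0) = b := rfl
  rw [e4, e5, e6] at h
  rw [swap c b] at h
  linear_combination h

open Finset in
/-- The three-term Plücker relation for maximal minors with columns in increasing order. -/
theorem pMinor_plucker {R : Type*} [CommRing R] {k n : ℕ} (A : Matrix (Fin k) (Fin n) R)
    {S : Finset (Fin n)} (hS : S.card + 2 = k) {a b c d : Fin n} (hab : a < b) (hbc : b < c)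
    (hcd : c < d) (ha : a ∉ S) (hb : b ∉ S) (hc : c ∉ S) (hd : d ∉ S) :
    pMinor A (S ∪ {a, c}) * pMinor A (S ∪ {b, d}) =
      pMinor A (S ∪ {a, b}) * pMinor A (S ∪ {c, d}) +
      pMinor A (S ∪ {a, d}) * pMinor A (S ∪ {b, c}) := by
  obtain ⟨m, hm⟩ : ∃ m, S.card = m := ⟨_, rfl⟩
  obtain rfl : k = m + 2 := by omega
  set s := S.orderEmbOfFin hm with hs
  have hsS : ∀ i, s i ∈ S := S.orderEmbOfFin_mem hm
  set E : Fin n → ℤ := fun x => (∏ i, (((s i : ℕ) : ℤ) - (x : ℕ))).sign with hE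
  set w : ℤ := (vandermondeProd fun i => ((s i : ℕ) : ℤ)).sign with hw
  have hw2 : w = 1 := Int.sign_eq_one_of_pos (vandermondeProd_pos fun x y h => by
    have := s.strictMono h
    exact_mod_cast this)
  have hE2 : ∀ x ∉ S, E x * E x = 1 := fun x hx => by
    rw [hE, ← Int.sign_mul]
    refine Int.sign_eq_one_of_pos (mul_self_pos.2 (prod_ne_zero_iff.2 fun i _ h => hx ?_))
    have : s i = x := Fin.ext (by omega)
    exact this ▸ hsS i
  have hdet : ∀ x y, x < y → x ∉ S → y ∉ S →
      (Matrix.of (Fin.cons (fun r => A r x) (Fin.cons (fun r => A r y)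
        (fun i r => A r (s i)) : Fin (m + 1) → _) : Fin (m + 2) → _)).det =
      ((E x * E y : ℤ) : R) * pMinor A (S ∪ {x, y}) := fun x y hxy hx hy => by
    set f : Fin (m + 2) → Fin n := Fin.cons x (Fin.cons y s : Fin (m + 1) → Fin n) with hf
    have hinj : Function.Injective f := by
      rw [hf, Fin.cons_injective_iff, Fin.cons_injective_iff]
      refine ⟨?_, ?_, s.injective⟩
      · rintro ⟨i, hi⟩
        refine Fin.cases (fun hi => hxy.ne' hi) (fun i hi => ?_) i hi
        exact hx (by rw [← hi]; exact hsS i)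
      · rintro ⟨i, rfl⟩
        exact hy (hsS i)
    have hcard : (S ∪ {x, y}).card = m + 2 := by
      rw [card_union_of_disjoint (by simp [hx, hy]), card_pair hxy.ne, hm]
    have h := det_submatrix_eq_sign_mul_pMinor A hinj hcard (fun l => by
      refine Fin.cases ?_ (fun l => Fin.cases ?_ (fun l => ?_) l) l
      · simp [hf]
      · simp [hf]
      · exact mem_union_left _ (hsS l))
    have hv : (fun l => ((f l : ℕ) : ℤ)) = (Fin.cons ((x : ℕ) : ℤ)
        (Fin.cons ((y : ℕ) : ℤ) (fun i => ((s i : ℕ) : ℤ)) : Fin (m + 1) → ℤ) :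
          Fin (m + 2) → ℤ) := by
      funext l
      exact Fin.cases rfl (fun l => Fin.cases rfl (fun l => rfl) l) l
    have hsgn : (vandermondeProd fun l => ((f l : ℕ) : ℤ)).sign = E x * E y := by
      rw [hv, vandermondeProd_cons, vandermondeProd_cons, Fin.prod_univ_succ]
      simp only [Fin.cons_zero, Fin.cons_succ, Int.sign_mul]
      rw [← hw, hw2, Int.sign_eq_one_of_pos (a := ((y : ℕ) : ℤ) - (x : ℕ)) (by
        have : (x : ℕ) < y := hxy
        omega)]
      simp [hE]
    rw [← hsgn, ← h, ← Matrix.det_transpose]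
    congr 1
    ext r l
    exact Fin.cases rfl (fun l => Fin.cases rfl (fun l => rfl) l) l
  have h := det_cons_cons_plucker (fun i r => A r (s i)) (fun r => A r a) (fun r => A r b)
    (fun r => A r c) (fun r => A r d)
  rw [hdet a c (hab.trans hbc) ha hc, hdet b d (hbc.trans hcd) hb hd, hdet a b hab ha hb,
    hdet c d hcd hc hd, hdet a d (hab.trans (hbc.trans hcd)) ha hd, hdet b c hbc hb hc] at h
  have hsq : ((E a : R) * E b * E c * E d) * (E a * E b * E c * E d) = 1 := by
    have : (E a * E a) * (E b * E b) * (E c * E c) * (E d * E d) = 1 := by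
      rw [hE2 a ha, hE2 b hb, hE2 c hc, hE2 d hd]; rfl
    have := congrArg (Int.cast : ℤ → R) this
    push_cast at this
    linear_combination this
  push_cast at h
  linear_combination ((E a : R) * E b * E c * E d) * h - (pMinor A (S ∪ {a, c}) *
    pMinor A (S ∪ {b, d}) - pMinor A (S ∪ {a, b}) * pMinor A (S ∪ {c, d}) -
    pMinor A (S ∪ {a, d}) * pMinor A (S ∪ {b, c})) * hsq

/-- The Hahn series `f` has order `r` and positive leading coefficient. -/
def HasPosOrder (f : HahnSeries ℝ ℝ) (r : ℝ) : Prop :=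
  0 < f.leadingCoeff ∧ f.order = r

namespace HasPosOrder

variable {f g : HahnSeries ℝ ℝ} {r s : ℝ}

theorem ne_zero (hf : HasPosOrder f r) : f ≠ 0 :=
  HahnSeries.leadingCoeff_ne_zero.1 hf.1.ne'

theorem iff_coeff : HasPosOrder f r ↔ 0 < f.coeff r ∧ ∀ s < r, f.coeff s = 0 := by
  constructor
  · rintro ⟨h, rfl⟩
    exact ⟨by rwa [← HahnSeries.leadingCoeff_eq], fun s hs =>
      HahnSeries.coeff_eq_zero_of_lt_order hs⟩
  · rintro ⟨h, h0⟩
    have hne : f ≠ 0 := by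
      rintro rfl
      simp at h
    have ho : f.order = r := by
      refine le_antisymm (HahnSeries.order_le_of_coeff_ne_zero h.ne') (not_lt.1 fun hlt => ?_)
      exact hne (HahnSeries.leadingCoeff_eq_zero.1 (by
        rw [HahnSeries.leadingCoeff_eq]; exact h0 _ hlt))
    exact ⟨by rwa [HahnSeries.leadingCoeff_eq, ho], ho⟩

theorem mul (hf : HasPosOrder f r) (hg : HasPosOrder g s) : HasPosOrder (f * g) (r + s) := by
  refine ⟨by rw [HahnSeries.leadingCoeff_mul]; exact mul_pos hf.1 hg.1, ?_⟩
  rw [HahnSeries.order_mul_of_ne_zero (mul_pos hf.1 hg.1).ne', hf.2, hg.2]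

theorem add (hf : HasPosOrder f r) (hg : HasPosOrder g s) : HasPosOrder (f + g) (min r s) := by
  rw [iff_coeff] at *
  refine ⟨?_, fun t ht => ?_⟩
  · rcases lt_trichotomy r s with h | rfl | h
    · rw [min_eq_left h.le, HahnSeries.coeff_add, hg.2 _ h]
      simpa using hf.1
    · rw [min_self, HahnSeries.coeff_add]
      exact add_pos hf.1 hg.1
    · rw [min_eq_right h.le, HahnSeries.coeff_add, hf.2 _ h]
      simpa using hg.1
  · rw [HahnSeries.coeff_add, hf.2 _ (ht.trans_le (min_le_left _ _)),
      hg.2 _ (ht.trans_le (min_le_right _ _)), add_zero]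

theorem of_mul_left (hf : HasPosOrder f r) (hfg : HasPosOrder (f * g) (r + s)) :
    HasPosOrder g s := by
  have h1 := hfg.1
  have h2 := hfg.2
  rw [HahnSeries.leadingCoeff_mul] at h1
  rw [HahnSeries.order_mul_of_ne_zero h1.ne', hf.2] at h2
  exact ⟨(mul_pos_iff_of_pos_left hf.1).1 h1, by linarith⟩

end HasPosOrder

/-- The injection `Fin k → ℕ` enumerating `{0, …, a - 1} ∪ {b + a, …, b + k - 1}`. -/
def twoIntervals (k a b : ℕ) (l : Fin k) : ℕ :=
  if (l : ℕ) < a then l else b + l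

/-- There are vectors whose minors on all the sets `{0, …, a - 1} ∪ {b + a, …, b + k - 1}`
take prescribed nonzero values. -/
theorem exists_det_twoIntervals_eq {F : Type*} [Field F] {k : ℕ} (hk : 0 < k)
    (τ : (Fin k → ℕ) → F) (hτ : ∀ f, τ f ≠ 0) (N : ℕ) :
    ∃ A : ℕ → Fin k → F, ∀ a ≤ k, ∀ b ≤ N,
      (Matrix.of fun l => A (twoIntervals k a b l)).det = τ (twoIntervals k a b) := by
  induction N with
  | zero =>
    have hid : ∀ a, twoIntervals k a 0 = fun l : Fin k => (l : ℕ) := fun a => by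
      funext l
      simp [twoIntervals]
    set D : Matrix (Fin k) (Fin k) F :=
      Matrix.diagonal (Function.update 1 ⟨0, hk⟩ (τ fun l : Fin k => (l : ℕ))) with hD
    refine ⟨fun i => if h : i < k then D ⟨i, h⟩ else 0, fun a _ b hb => ?_⟩
    obtain rfl : b = 0 := by omega
    rw [hid]
    have : (Matrix.of fun l : Fin k => if h : (l : ℕ) < k then D ⟨l, h⟩ else 0) = D := by
      ext i j
      simp
    rw [this, hD, Matrix.det_diagonal, Finset.prod_update_of_mem (Finset.mem_univ _)]
    simp
  | succ b ih =>
    obtain ⟨A, hA⟩ := ih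
    set B : Fin k → Matrix (Fin k) (Fin k) F := fun a =>
      Matrix.of fun l => A (twoIntervals k (a + 1) b l) with hB
    have hBdet : ∀ a : Fin k, (B a).det ≠ 0 := fun a => by
      rw [hB, hA _ (by omega) b le_rfl]
      exact hτ _
    have hσ : ∀ a : Fin k, ∃ σ : Equiv.Perm (Fin k), ∀ l : Fin k,
        twoIntervals k a (b + 1) (σ l) =
          if l = a then b + k else twoIntervals k (a + 1) b l := fun a => by
      let s : Fin k → Fin k := fun l =>
        if (l : ℕ) < a then l else if l = a then ⟨k - 1, by omega⟩ else ⟨l - 1, by omega⟩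
      have hsv : ∀ l, (s l : ℕ) =
          if (l : ℕ) < a then (l : ℕ) else if (l : ℕ) = a then k - 1 else l - 1 := fun l => by
        simp only [s, Fin.ext_iff]
        split_ifs <;> rfl
      have hs : Function.Injective s := fun x y h => by
        have h := congrArg Fin.val h
        rw [hsv, hsv] at h
        refine Fin.ext ?_
        split_ifs at h <;> omega
      refine ⟨Equiv.ofBijective s (Finite.injective_iff_bijective.1 hs), fun l => ?_⟩
      rw [Equiv.ofBijective_apply]
      simp only [twoIntervals, hsv, Fin.ext_iff]
      split_ifs <;> omega
    choose σ hσ using hσ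
    set T : Matrix (Fin k) (Fin k) F :=
      Matrix.of fun a i => Matrix.cramer (B a).transpose (A i) a with hT
    have hTdet : T.det ≠ 0 := by
      rw [Matrix.det_of_isUpperTriangular]
      · refine Finset.prod_ne_zero_iff.2 fun a _ => ?_
        have : A a = B a a := by
          funext j
          simp [hB, twoIntervals]
        simp only [hT, Matrix.of_apply, Matrix.cramer_transpose_apply]
        rw [this, Matrix.updateRow_eq_self]
        exact hBdet a
      · intro a i hia
        have hia : i < a := hia
        simp only [hT, Matrix.of_apply, Matrix.cramer_transpose_apply]
        refine Matrix.det_zero_of_row_eq hia.ne ?_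
        rw [Matrix.updateRow_self, Matrix.updateRow_ne hia.ne]
        funext j
        simp [hB, twoIntervals, hia.le]
    set y : Fin k → F := fun a =>
      (((σ a).sign : ℤ) : F) * τ (twoIntervals k a (b + 1)) with hy
    set x := T⁻¹.mulVec y with hx
    have hTx : T.mulVec x = y := by
      rw [hx, Matrix.mulVec_mulVec, Matrix.mul_nonsing_inv _ (isUnit_iff_ne_zero.2 hTdet),
        Matrix.one_mulVec]
    set v : Fin k → F := ∑ i : Fin k, x i • A i with hv
    have hsolve : ∀ a, ((B a).updateRow a v).det = y a := fun a => by
      rw [← Matrix.cramer_transpose_apply, ← hTx, hv]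
      simp [hT, Matrix.mulVec, dotProduct, mul_comm]
    refine ⟨Function.update A (b + k) v, fun a ha b' hb' => ?_⟩
    have hold : ∀ a' b', (b' ≤ b ∨ a' = k) →
        (fun l => Function.update A (b + k) v (twoIntervals k a' b' l)) =
          fun l => A (twoIntervals k a' b' l) := fun a' b' h => by
      funext l
      rw [Function.update_of_ne]
      unfold twoIntervals
      split_ifs <;> omega
    rcases Nat.lt_or_ge b b' with hlt | hle
    · obtain rfl : b' = b + 1 := by omega
      rcases ha.lt_or_eq with hak | rfl
      · have h := Matrix.det_permute (σ ⟨a, hak⟩) (Matrix.of fun l =>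
          Function.update A (b + k) v (twoIntervals k a (b + 1) l))
        have heq : (Matrix.of fun l => Function.update A (b + k) v
            (twoIntervals k a (b + 1) l)).submatrix (σ ⟨a, hak⟩) id =
            (B ⟨a, hak⟩).updateRow ⟨a, hak⟩ v := by
          ext l j
          have hl := hσ ⟨a, hak⟩ l
          simp only at hl
          rw [Matrix.submatrix_apply, Matrix.of_apply, hl, Matrix.updateRow_apply]
          split_ifs with hla
          · simp
          · rw [Function.update_of_ne]
            · simp [hB]
            · unfold twoIntervals
              split_ifs <;> omega
        rw [heq, hsolve, hy] at h
        rcases Int.units_eq_one_or (σ ⟨a, hak⟩).sign with h1 | h1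
        · simpa [h1] using h.symm
        · simpa [h1] using h.symm
      · have hka : twoIntervals a a (b + 1) = twoIntervals a a 0 := by
          funext l
          simp [twoIntervals]
        rw [hka, hold _ _ (Or.inr rfl)]
        exact hA _ le_rfl _ (Nat.zero_le _)
    · rw [hold _ _ (Or.inl hle)]
      exact hA _ ha _ hle

open Finset in
/-- Induction principle for `k`-subsets: a property that holds for unions of an initial interval
with another interval, and that propagates along three-term relations, holds for all
`k`-subsets. -/
theorem card_subset_induction {k n : ℕ} (hkn : k < n) {Φ : Finset (Fin n) → Prop}
    (hbase : ∀ (I : Finset (Fin n)) (hI : I.card = k) (a b : ℕ), a ≤ k → b ≤ n →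
      (∀ l, (I.orderEmbOfFin hI l : ℕ) = twoIntervals k a b l) → Φ I)
    (hstep : ∀ S : Finset (Fin n), S.card + 2 = k → ∀ a b c d : Fin n, a < b → b < c → c < d →
      a ∉ S → b ∉ S → c ∉ S → d ∉ S → Φ (S ∪ {a, b}) → Φ (S ∪ {c, d}) → Φ (S ∪ {a, d}) →
      Φ (S ∪ {b, c}) → Φ (S ∪ {a, c}) → Φ (S ∪ {b, d}))
    (I : Finset (Fin n)) (hI : I.card = k) : Φ I := by
  suffices H : ∀ e a, a + e = k → ∀ I : Finset (Fin n), I.card = k →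
      (∀ i : Fin n, (i : ℕ) < a → i ∈ I) → Φ I from
    H k 0 (Nat.zero_add k) I hI fun i hi => absurd hi (Nat.not_lt_zero _)
  clear hI I
  intro e
  induction e with
  | zero =>
    rintro a rfl I hI hpre
    refine hbase I hI a 0 le_rfl (Nat.zero_le _) fun l => ?_
    have := I.orderEmbOfFin_unique hI (f := fun l : Fin a => (⟨l, by omega⟩ : Fin n))
      (fun l => hpre _ l.2) (fun x y h => h)
    rw [← this]
    simp [twoIntervals]
  | succ e ih =>
    intro a hae
    set a' : Fin n := ⟨a, by omega⟩ with ha'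
    have key : ∀ w : ℕ, ∀ I : Finset (Fin n), I.card = k → (∀ i : Fin n, (i : ℕ) < a → i ∈ I) →
        (∀ x ∈ I, ∀ y ∈ I, a ≤ (x : ℕ) → (y : ℕ) ≤ x + w) → Φ I := by
      intro w
      induction w using Nat.strong_induction_on with
      | _ w ihw =>
      intro I hI hpre hw
      by_cases haI : a' ∈ I
      · refine ih (a + 1) (by omega) I hI fun i hi => ?_
        rcases Nat.lt_succ_iff_lt_or_eq.1 hi with h | h
        · exact hpre i h
        · rwa [show i = a' from Fin.ext h]
      have hJ : (I.filter fun i => a' ≤ i).Nonempty := by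
        by_contra hne
        rw [not_nonempty_iff_eq_empty, filter_eq_empty_iff] at hne
        have : I.card ≤ (Iio a').card :=
          card_le_card fun i hi => mem_Iio.2 (not_le.1 (hne hi))
        rw [Fin.card_Iio, hI] at this
        simp only [ha'] at this
        omega
      set b := (I.filter fun i => a' ≤ i).min' hJ with hb
      set d := (I.filter fun i => a' ≤ i).max' hJ with hd
      obtain ⟨hbI, hab⟩ := mem_filter.1 (min'_mem _ hJ)
      obtain ⟨hdI, had⟩ := mem_filter.1 (max'_mem _ hJ)
      rw [← hb] at hbI hab
      rw [← hd] at hdI had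
      have hbd : ∀ i ∈ I, a' ≤ i → b ≤ i ∧ i ≤ d := fun i hi hai =>
        ⟨min'_le _ _ (mem_filter.2 ⟨hi, hai⟩), le_max' _ _ (mem_filter.2 ⟨hi, hai⟩)⟩
      have hab : a' < b := lt_of_le_of_ne hab fun h => haI (h ▸ hbI)
      by_cases hgap : ∃ c, b < c ∧ c < d ∧ c ∉ I
      · obtain ⟨c, hbc, hcd, hc⟩ := hgap
        have hbd' : b ≠ d := (hbc.trans hcd).ne
        set S := (I.erase b).erase d with hS
        have hSI : ∀ i ∈ S, i ∈ I := fun i hi => mem_of_mem_erase (mem_of_mem_erase hi)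
        have hScard : S.card + 2 = k := by
          have h1 := card_erase_add_one hbI
          have h2 : S.card + 1 = (I.erase b).card :=
            card_erase_add_one (mem_erase.2 ⟨hbd'.symm, hdI⟩)
          omega
        have hSU : S ∪ {b, d} = I := by
          ext i
          simp only [hS, mem_union, mem_erase, mem_insert, mem_singleton]
          constructor
          · rintro (h | rfl | rfl)
            exacts [h.2.2, hbI, hdI]
          · tauto
        have hcardS : ∀ x y, x ≠ y → x ∉ S → y ∉ S → (S ∪ {x, y}).card = k :=
          fun x y hxy hx hy => by
            rw [card_union_of_disjoint (by simp [hx, hy]), card_pair hxy, hScard]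
        have hpreS : ∀ i : Fin n, (i : ℕ) < a → i ∈ S := fun i hi => by
          have hia : i < a' := hi
          exact mem_erase.2 ⟨(hia.trans_le had).ne, mem_erase.2 ⟨(hia.trans hab).ne, hpre i hi⟩⟩
        have hSbd : ∀ i ∈ S, a' ≤ i → b < i ∧ i < d := fun i hi hai => by
          obtain ⟨h1, h2⟩ := hbd i (hSI i hi) hai
          have h3 := mem_erase.1 hi
          exact ⟨lt_of_le_of_ne h1 (mem_erase.1 h3.2).1.symm, lt_of_le_of_ne h2 h3.1⟩
        have haS : a' ∉ S := fun h => haI (hSI _ h)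
        have hbS : b ∉ S := by simp [hS]
        have hcS : c ∉ S := fun h => hc (hSI _ h)
        have hdS : d ∉ S := by simp [hS]
        have hin : ∀ x, a' < x → x ∉ S → Φ (S ∪ {a', x}) := fun x hax hx => by
          refine ih (a + 1) (by omega) _ (hcardS _ _ hax.ne haS hx) fun i hi => ?_
          rcases Nat.lt_succ_iff_lt_or_eq.1 hi with h | h
          · exact mem_union_left _ (hpreS i h)
          · rw [show i = a' from Fin.ext h]
            simp
        have hwid : (d : ℕ) ≤ b + w := hw b hbI d hdI (le_of_lt hab)
        have hbc' : (b : ℕ) < c := hbc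
        have hcd' : (c : ℕ) < d := hcd
        rw [← hSU]
        refine hstep S hScard a' b c d hab hbc hcd haS hbS hcS hdS (hin b hab hbS) ?_
          (hin d (hab.trans (hbc.trans hcd)) hdS) ?_ (hin c (hab.trans hbc) hcS)
        · refine ihw (w - 1) (by omega) _ (hcardS _ _ hcd.ne hcS hdS)
            (fun i hi => mem_union_left _ (hpreS i hi)) ?_
          have hlo : ∀ x ∈ S ∪ {c, d}, a ≤ (x : ℕ) → (b : ℕ) < x ∧ (x : ℕ) ≤ d := by
            intro x hx hax
            simp only [mem_union, mem_insert, mem_singleton] at hx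
            rcases hx with hx | rfl | rfl
            · exact ⟨(hSbd x hx hax).1, (hSbd x hx hax).2.le⟩
            · omega
            · omega
          intro x hx y hy hax
          have h1 := hlo x hx hax
          by_cases hay : a ≤ (y : ℕ)
          · have h2 := hlo y hy hay
            omega
          · omega
        · refine ihw (w - 1) (by omega) _ (hcardS _ _ hbc.ne hbS hcS)
            (fun i hi => mem_union_left _ (hpreS i hi)) ?_
          have hlo : ∀ x ∈ S ∪ {b, c}, a ≤ (x : ℕ) → (b : ℕ) ≤ x ∧ (x : ℕ) < d := by
            intro x hx hax
            simp only [mem_union, mem_insert, mem_singleton] at hx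
            rcases hx with hx | rfl | rfl
            · exact ⟨(hSbd x hx hax).1.le, (hSbd x hx hax).2⟩
            · omega
            · omega
          intro x hx y hy hax
          have h1 := hlo x hx hax
          by_cases hay : a ≤ (y : ℕ)
          · have h2 := hlo y hy hay
            omega
          · omega
      · push Not at hgap
        have hIcc : ∀ i, b ≤ i → i ≤ d → i ∈ I := fun i h1 h2 => by
          rcases h1.eq_or_lt with rfl | h1
          · exact hbI
          rcases h2.eq_or_lt with rfl | h2
          · exact hdI
          exact hgap i h1 h2
        have hIeq : I = Iio a' ∪ Icc b d := by
          ext i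
          simp only [mem_union, mem_Iio, mem_Icc]
          constructor
          · intro hi
            rcases lt_or_ge i a' with h | h
            exacts [Or.inl h, Or.inr (hbd i hi h)]
          · rintro (h | h)
            exacts [hpre i h, hIcc i h.1 h.2]
        have hcard : a + ((d : ℕ) + 1 - b) = k := by
          rw [← hI, hIeq, card_union_of_disjoint, Fin.card_Iio, Fin.card_Icc]
          refine disjoint_left.2 fun i h1 h2 => ?_
          exact absurd ((mem_Iio.1 h1).trans hab) (not_lt.2 (mem_Icc.1 h2).1)
        have hab' : a < (b : ℕ) := hab
        have hmem : ∀ l : Fin k, ∃ i ∈ I, (i : ℕ) = twoIntervals k a (b - a) l := fun l => by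
          unfold twoIntervals
          split_ifs with h
          · exact ⟨⟨l, by omega⟩, hpre _ h, rfl⟩
          · refine ⟨⟨b - a + l, by omega⟩, hIcc _ ?_ ?_, rfl⟩
            · change (b : ℕ) ≤ b - a + l
              omega
            · change (b : ℕ) - a + l ≤ d
              omega
        choose f hfI hf using hmem
        have hmono : StrictMono f := fun x y hxy => by
          have hxy : (x : ℕ) < y := hxy
          change (f x : ℕ) < f y
          rw [hf, hf]
          unfold twoIntervals
          split_ifs <;> omega
        refine hbase I hI a (b - a) (by omega) (by omega) fun l => ?_
        rw [← I.orderEmbOfFin_unique hI hfI hmono, hf]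
    exact fun I hI hpre => key n I hI hpre fun x _ y _ _ => by omega
/-- The positive Dressian equals the positive tropical Grassmannian:
`P` is a positive tropical Plücker vector if and only if it arises as the
vector of valuations of the maximal minors of a `k × n` matrix over the field
of generalized Puiseux series whose maximal minors are all nonzero with
positive leading coefficients. -/
theorem stmt_0 (k n : ℕ) (hk : 0 < k) (hkn : k < n) (P : Finset (Fin n) → ℝ) :
    IsPosTropPlucker n k P ↔
      ∃ A : Matrix (Fin k) (Fin n) (HahnSeries ℝ ℝ),
        ∀ I : Finset (Fin n), I.card = k →
          pMinor A I ≠ 0 ∧ 0 < lc (pMinor A I) ∧ ord (pMinor A I) = P I := by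
  constructor
  · intro hP
    obtain ⟨V, hV⟩ := exists_det_twoIntervals_eq hk
      (fun f => HahnSeries.single (P (Finset.univ.filter fun i : Fin n => ∃ l, f l = i)) (1 : ℝ))
      (fun f => by simp) n
    set A : Matrix (Fin k) (Fin n) (HahnSeries ℝ ℝ) := Matrix.of fun r c => V c r with hA
    refine ⟨A, fun I hI => ?_⟩
    suffices h : HasPosOrder (pMinor A I) (P I) from ⟨h.ne_zero, h⟩
    refine card_subset_induction hkn (Φ := fun I => HasPosOrder (pMinor A I) (P I)) ?_ ?_ I hI
    · intro I hI a b ha hb he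
      have hfil : (Finset.univ.filter fun i : Fin n => ∃ l, twoIntervals k a b l = i) = I := by
        ext i
        rw [Finset.mem_filter_univ]
        constructor
        · rintro ⟨l, hl⟩
          rw [← he] at hl
          rw [← Fin.ext hl]
          exact I.orderEmbOfFin_mem hI l
        · intro hi
          obtain ⟨l, rfl⟩ : i ∈ Set.range (I.orderEmbOfFin hI) := by
            rw [Finset.range_orderEmbOfFin]
            exact hi
          exact ⟨l, (he l).symm⟩
      have hmin : pMinor A I = HahnSeries.single (P I) 1 := by
        rw [pMinor, dif_pos hI, ← Matrix.det_transpose]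
        have h := hV a ha b hb
        simp only [hfil] at h
        rw [← h]
        congr 1
        ext l r : 2
        simp [hA, ← he]
      rw [hmin]
      exact ⟨by simp, HahnSeries.order_single one_ne_zero⟩
    · intro S hS a b c d hab hbc hcd ha hb hc hd h1 h2 h3 h4 h5
      refine h5.of_mul_left ?_
      rw [pMinor_plucker A hS hab hbc hcd ha hb hc hd]
      convert (h1.mul h2).add (h3.mul h4) using 1
      rcases hP S hS a b c d hab hbc hcd ha hb hc hd with ⟨h, hle⟩ | ⟨h, hle⟩
      · rw [h, min_eq_left hle]
      · rw [h, min_eq_right hle]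
  · rintro ⟨A, hA⟩ S hS a b c d hab hbc hcd ha hb hc hd
    have hpos : ∀ x y, x ≠ y → x ∉ S → y ∉ S →
        HasPosOrder (pMinor A (S ∪ {x, y})) (P (S ∪ {x, y})) := fun x y hxy hx hy =>
      (hA _ (by rw [Finset.card_union_of_disjoint (by simp [hx, hy]), Finset.card_pair hxy, hS])).2
    have h1 := (hpos a c (hab.trans hbc).ne ha hc).mul (hpos b d (hbc.trans hcd).ne hb hd)
    rw [pMinor_plucker A hS hab hbc hcd ha hb hc hd] at h1
    have h2 := ((hpos a b hab.ne ha hb).mul (hpos c d hcd.ne hc hd)).add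
      ((hpos a d (hab.trans (hbc.trans hcd)).ne ha hd).mul (hpos b c hbc.ne hb hc))
    have h := h1.2.symm.trans h2.2
    rcases min_choice (P (S ∪ {a, b}) + P (S ∪ {c, d})) (P (S ∪ {a, d}) + P (S ∪ {b, c}))
      with h' | h'
    · exact Or.inl ⟨h.trans h', min_eq_left_iff.1 h'⟩
    · exact Or.inr ⟨h.trans h', min_eq_right_iff.1 h'⟩
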